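/- Interpolation estimate for the sewing map: Let 0 < α < 1 < β, T > 0, V a Banach space and R > 0. There exists a constant C = C(T,β) such that for every Γ ∈ C₂^{α,β}([0,T];V) with ‖δΓ‖_β ≤ R and ‖Γ‖_α ≤ ‖δΓ‖_β, the sewing satisfies ⟦𝒥(Γ)⟧_α ≤ C (1 + R) ‖Γ‖_α^{(β−1)/(β−α)}. Consequently, if {Γⁿ} ⊆ C₂^{α,β}([0,T];V) is a sequence with sup_n ‖δΓⁿ‖_β ≤ R and ‖Γⁿ‖_α → 0, then ⟦𝒥(Γⁿ)⟧_α → 0, i.e. 𝒥(Γⁿ) → 0 in C^α([0,T];V). -/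

import Mathlib

/-- The `α`-Hölder seminorm of a path on `[0,T]`. -/
noncomputable def holderSemiOn {V : Type*} [NormedAddCommGroup V] (α T : ℝ) (f : ℝ → V) : ℝ :=
  sSup {r : ℝ | ∃ s t : ℝ, 0 ≤ s ∧ s < t ∧ t ≤ T ∧ r = ‖f t - f s‖ / (t - s) ^ α}

/-- A two-parameter map that is `O((t - s) ^ β)` for some constant is bounded by the constant
`D` of its defect of additivity, up to the factor `1 / (1 - 2 ^ (1 - β))`. -/
theorem norm_le_of_defect_le {V : Type*} [NormedAddCommGroup V] {β T D K : ℝ} (hβ : 1 < β)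
    {E : ℝ → ℝ → V}
    (hδ : ∀ s u t : ℝ, 0 ≤ s → s ≤ u → u ≤ t → t ≤ T →
      ‖E s t - E s u - E u t‖ ≤ D * (t - s) ^ β)
    (hK : ∀ s t : ℝ, 0 ≤ s → s ≤ t → t ≤ T → ‖E s t‖ ≤ K * (t - s) ^ β)
    {s t : ℝ} (hs : 0 ≤ s) (hst : s ≤ t) (ht : t ≤ T) :
    ‖E s t‖ ≤ D / (1 - 2 ^ (1 - β)) * (t - s) ^ β := by
  set q : ℝ := 2 ^ (1 - β) with hq
  have hq0 : 0 < q := Real.rpow_pos_of_pos two_pos _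
  have hq1 : q < 1 := Real.rpow_lt_one_of_one_lt_of_neg one_lt_two (by linarith)
  have half (h : ℝ) (hh : 0 ≤ h) : 2 * (h / 2) ^ β = q * h ^ β := by
    rw [Real.div_rpow hh zero_le_two, hq, Real.rpow_sub two_pos, Real.rpow_one]
    ring
  have iter (n : ℕ) : ∀ s t : ℝ, 0 ≤ s → s ≤ t → t ≤ T →
      ‖E s t‖ ≤ (q ^ n * (K - D / (1 - q)) + D / (1 - q)) * (t - s) ^ β := by
    induction n with
    | zero => simpa using hK
    | succ n ih =>
      intro s t hs hst ht
      set A := q ^ n * (K - D / (1 - q)) + D / (1 - q) with hA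
      have h1 := ih s ((s + t) / 2) hs (by linarith) (by linarith)
      have h2 := ih ((s + t) / 2) t (by linarith) (by linarith) ht
      rw [show (s + t) / 2 - s = (t - s) / 2 by ring] at h1
      rw [show t - (s + t) / 2 = (t - s) / 2 by ring] at h2
      have h3 := hδ s ((s + t) / 2) t hs (by linarith) (by linarith) ht
      have hsum : ‖E s t‖ ≤ ‖E s t - E s ((s + t) / 2) - E ((s + t) / 2) t‖
          + ‖E s ((s + t) / 2)‖ + ‖E ((s + t) / 2) t‖ := by
        refine le_of_eq_of_le (congrArg norm ?_) norm_add₃_le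
        abel
      have hhalf := half (t - s) (by linarith)
      have hcoef : q ^ (n + 1) * (K - D / (1 - q)) + D / (1 - q) = A * q + D := by
        have : 1 - q ≠ 0 := by linarith
        rw [hA]
        field_simp
        ring
      rw [hcoef]
      linear_combination hsum + h1 + h2 + h3 + A * hhalf
  have hlim : Filter.Tendsto
      (fun n : ℕ => (q ^ n * (K - D / (1 - q)) + D / (1 - q)) * (t - s) ^ β) Filter.atTop
      (nhds ((0 * (K - D / (1 - q)) + D / (1 - q)) * (t - s) ^ β)) :=
    (((tendsto_pow_atTop_nhds_zero_of_lt_one hq0.le hq1).mul_const _).add_const _).mul_const _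
  rw [zero_mul, zero_add] at hlim
  exact ge_of_tendsto' hlim fun n => iter n s t hs hst ht

/-- A Hölder bound at scales at most `ε` extends to all scales. -/
theorem norm_sub_le_of_small_scales {V : Type*} [NormedAddCommGroup V] {α ε B T : ℝ}
    (hα0 : 0 ≤ α) (hα1 : α ≤ 1) (hε : 0 < ε) (hB : 0 ≤ B) {I : ℝ → V}
    (hI : ∀ s t : ℝ, 0 ≤ s → s ≤ t → t ≤ T → t - s ≤ ε → ‖I t - I s‖ ≤ B * (t - s) ^ α)
    {s t : ℝ} (hs : 0 ≤ s) (hst : s ≤ t) (ht : t ≤ T) :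
    ‖I t - I s‖ ≤ B * (1 + ((t - s) / ε) ^ (1 - α)) * (t - s) ^ α := by
  have hh : 0 ≤ t - s := sub_nonneg.2 hst
  set N : ℕ := ⌊(t - s) / ε⌋₊ + 1 with hN
  have hN0 : (0 : ℝ) < N := by positivity
  have hNle : (N : ℝ) ≤ 1 + (t - s) / ε := by
    have := Nat.floor_le (div_nonneg hh hε.le)
    rw [hN]; push_cast; linarith
  set d : ℝ := (t - s) / N with hd
  have hd0 : 0 ≤ d := by positivity
  have hdN : N * d = t - s := by rw [hd]; field_simp
  have hdε : d ≤ ε := by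
    have := Nat.lt_floor_add_one ((t - s) / ε)
    rw [div_lt_iff₀ hε] at this
    rw [hd, div_le_iff₀ hN0, hN]; push_cast; linarith
  have chain (k : ℕ) (hk : k ≤ N) : ‖I (s + k * d) - I s‖ ≤ k * (B * d ^ α) := by
    induction k with
    | zero => simp
    | succ k ih =>
      have hk' : ((k + 1 : ℕ) : ℝ) * d ≤ N * d := by gcongr
      have hkd : (0 : ℝ) ≤ k * d := by positivity
      push_cast at hk' ⊢
      have h1 := ih (by omega)
      have h2 := hI (s + k * d) (s + (k + 1) * d) (by linarith) (by linarith) (by linarith)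
        (by linarith)
      rw [show s + (k + 1) * d - (s + k * d) = d by ring] at h2
      have h3 := norm_sub_le_norm_sub_add_norm_sub (I (s + (k + 1) * d)) (I (s + k * d)) (I s)
      linarith
  have hmain := chain N le_rfl
  rw [hdN, add_sub_cancel] at hmain
  have hpow : N * d ^ α = (N : ℝ) ^ (1 - α) * (t - s) ^ α := by
    rw [hd, Real.div_rpow hh hN0.le, Real.rpow_sub hN0, Real.rpow_one]
    ring
  have hNpow : (N : ℝ) ^ (1 - α) ≤ 1 + ((t - s) / ε) ^ (1 - α) := by
    calc (N : ℝ) ^ (1 - α) ≤ (1 + (t - s) / ε) ^ (1 - α) :=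
          Real.rpow_le_rpow hN0.le hNle (by linarith)
      _ ≤ 1 ^ (1 - α) + ((t - s) / ε) ^ (1 - α) :=
          Real.rpow_add_le_add_rpow zero_le_one (by positivity) (by linarith) (by linarith)
      _ = _ := by rw [Real.one_rpow]
  calc ‖I t - I s‖ ≤ B * (N * d ^ α) := by linarith
    _ = B * (N : ℝ) ^ (1 - α) * (t - s) ^ α := by rw [hpow]; ring
    _ ≤ _ := by gcongr

/-- The interpolation bound for a path with `‖I t - I s‖ ≤ M (t - s) ^ α + c R (t - s) ^ β`. -/
theorem norm_sub_le_of_interpolation {V : Type*} [NormedAddCommGroup V] {α β c M R T : ℝ}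
    (hα0 : 0 < α) (hα1 : α < 1) (hβ : 1 < β) (hT : 0 < T) (hc : 0 ≤ c) (hM : 0 < M)
    (hMR : M ≤ R) {I : ℝ → V}
    (hI : ∀ s t : ℝ, 0 ≤ s → s ≤ t → t ≤ T →
      ‖I t - I s‖ ≤ M * (t - s) ^ α + c * R * (t - s) ^ β)
    {s t : ℝ} (hs : 0 ≤ s) (hst : s ≤ t) (ht : t ≤ T) :
    ‖I t - I s‖ ≤
      (1 + c) * (2 + T) * (1 + R) * M ^ ((β - 1) / (β - α)) * (t - s) ^ α := by
  have hR : 0 < R := hM.trans_le hMR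
  have hβα : 0 < β - α := by linarith
  set p : ℝ := (β - 1) / (β - α) with hp
  set θ : ℝ := (1 - α) / (β - α) with hθ
  have hθ0 : 0 ≤ θ := div_nonneg (by linarith) hβα.le
  have hpθ : p + θ = 1 := by rw [hp, hθ]; field_simp; ring
  have hp0 : 0 < p := div_pos (by linarith) hβα
  set ε : ℝ := (M / R) ^ (1 / (β - α)) with hεdef
  have hε : 0 < ε := by positivity
  have hεβ : R * ε ^ (β - α) = M := by
    rw [hεdef, ← Real.rpow_mul (by positivity), one_div_mul_cancel hβα.ne', Real.rpow_one]
    field_simp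
  have hεα : ε ^ (1 - α) = M ^ θ / R ^ θ := by
    rw [hεdef, ← Real.rpow_mul (by positivity), ← Real.div_rpow hM.le hR.le, hθ]
    congr 1
    ring
  have hMsplit : M = M ^ p * M ^ θ := by rw [← Real.rpow_add hM, hpθ, Real.rpow_one]
  have hRθ : R ^ θ ≤ 1 + R := by
    calc R ^ θ ≤ (1 + R) ^ θ := Real.rpow_le_rpow hR.le (by linarith) hθ0
      _ ≤ (1 + R) ^ (1 : ℝ) := Real.rpow_le_rpow_of_exponent_le (by linarith) (by linarith)
      _ = 1 + R := Real.rpow_one _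
  have hsmall : ∀ s t : ℝ, 0 ≤ s → s ≤ t → t ≤ T → t - s ≤ ε →
      ‖I t - I s‖ ≤ (1 + c) * M * (t - s) ^ α := by
    intro s t hs hst ht hle
    have hh : 0 ≤ t - s := sub_nonneg.2 hst
    have hsplit : (t - s) ^ β = (t - s) ^ (β - α) * (t - s) ^ α := by
      rw [← Real.rpow_add_of_nonneg hh hβα.le hα0.le, sub_add_cancel]
    calc ‖I t - I s‖ ≤ M * (t - s) ^ α + c * R * (t - s) ^ β := hI s t hs hst ht
      _ = M * (t - s) ^ α + c * (R * (t - s) ^ (β - α)) * (t - s) ^ α := by rw [hsplit]; ring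
      _ ≤ M * (t - s) ^ α + c * (R * ε ^ (β - α)) * (t - s) ^ α := by gcongr
      _ = (1 + c) * M * (t - s) ^ α := by rw [hεβ]; ring
  have hscale : M * (1 + ((t - s) / ε) ^ (1 - α)) ≤ (2 + T) * (1 + R) * M ^ p := by
    have hh : 0 ≤ t - s := sub_nonneg.2 hst
    have hTpow : (t - s) ^ (1 - α) ≤ 1 + T := by
      calc (t - s) ^ (1 - α) ≤ (1 + T) ^ (1 - α) :=
            Real.rpow_le_rpow hh (by linarith) (by linarith)
        _ ≤ (1 + T) ^ (1 : ℝ) := Real.rpow_le_rpow_of_exponent_le (by linarith) (by linarith)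
        _ = 1 + T := Real.rpow_one _
    have hMR' : M ^ θ ≤ R ^ θ := Real.rpow_le_rpow hM.le hMR hθ0
    have hMθ : 0 < M ^ θ := by positivity
    have hRθ0 : 0 < R ^ θ := by positivity
    calc M * (1 + ((t - s) / ε) ^ (1 - α))
        = M ^ p * (M ^ θ + (t - s) ^ (1 - α) * R ^ θ) := by
          rw [Real.div_rpow hh hε.le, hεα]
          nth_rewrite 1 [hMsplit]
          field_simp
      _ ≤ M ^ p * ((1 + R) + (1 + T) * (1 + R)) := by
          gcongr
          exact hMR'.trans hRθ
      _ = (2 + T) * (1 + R) * M ^ p := by ring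
  calc ‖I t - I s‖ ≤ (1 + c) * M * (1 + ((t - s) / ε) ^ (1 - α)) * (t - s) ^ α :=
        norm_sub_le_of_small_scales hα0.le hα1.le hε (by positivity) hsmall hs hst ht
    _ = (1 + c) * (M * (1 + ((t - s) / ε) ^ (1 - α))) * (t - s) ^ α := by ring
    _ ≤ (1 + c) * ((2 + T) * (1 + R) * M ^ p) * (t - s) ^ α := by
        have := sub_nonneg.2 hst
        gcongr
    _ = _ := by ring

/-- The constant of the interpolation estimate. -/
noncomputable def sewingInterpolationConst (β T : ℝ) : ℝ :=
  (1 + 1 / (1 - 2 ^ (1 - β))) * (2 + T)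

theorem sewingInterpolationConst_nonneg {β T : ℝ} (hβ : 1 < β) (hT : 0 < T) :
    0 ≤ sewingInterpolationConst β T := by
  have : (2 : ℝ) ^ (1 - β) < 1 := Real.rpow_lt_one_of_one_lt_of_neg one_lt_two (by linarith)
  have : 0 < 1 - (2 : ℝ) ^ (1 - β) := by linarith
  unfold sewingInterpolationConst
  positivity

theorem nonneg_of_germ_bound {V : Type*} [NormedAddCommGroup V] {α T M : ℝ} (hT : 0 < T)
    {Γ : ℝ → ℝ → V}
    (hΓ : ∀ s t : ℝ, 0 ≤ s → s ≤ t → t ≤ T → ‖Γ s t‖ ≤ M * (t - s) ^ α) : 0 ≤ M := by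
  have h := (norm_nonneg _).trans (hΓ 0 T le_rfl hT.le le_rfl)
  rw [sub_zero] at h
  exact nonneg_of_mul_nonneg_left h (Real.rpow_pos_of_pos hT α)

theorem norm_sewing_sub_le {V : Type*} [NormedAddCommGroup V] {α β M R T : ℝ}
    (hα0 : 0 < α) (hα1 : α < 1) (hβ : 1 < β) (hT : 0 < T) (hR : 0 < R) (hMR : M ≤ R)
    {Γ : ℝ → ℝ → V} {I : ℝ → V}
    (hΓ : ∀ s t : ℝ, 0 ≤ s → s ≤ t → t ≤ T → ‖Γ s t‖ ≤ M * (t - s) ^ α)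
    (hδ : ∀ s u t : ℝ, 0 ≤ s → s ≤ u → u ≤ t → t ≤ T →
      ‖Γ s t - Γ s u - Γ u t‖ ≤ R * (t - s) ^ β)
    (hI : ∃ K : ℝ, ∀ s t : ℝ, 0 ≤ s → s ≤ t → t ≤ T →
      ‖I t - I s - Γ s t‖ ≤ K * (t - s) ^ β)
    {s t : ℝ} (hs : 0 ≤ s) (hst : s ≤ t) (ht : t ≤ T) :
    ‖I t - I s‖ ≤
      sewingInterpolationConst β T * (1 + R) * M ^ ((β - 1) / (β - α)) * (t - s) ^ α := by
  obtain ⟨K, hK⟩ := hI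
  have hM : 0 ≤ M := nonneg_of_germ_bound hT hΓ
  have hq : (2 : ℝ) ^ (1 - β) < 1 := Real.rpow_lt_one_of_one_lt_of_neg one_lt_two (by linarith)
  have hc : 0 ≤ 1 / (1 - (2 : ℝ) ^ (1 - β)) := one_div_nonneg.2 (by linarith)
  have hp0 : 0 < (β - 1) / (β - α) := div_pos (by linarith) (by linarith)
  have hrem : ∀ s t : ℝ, 0 ≤ s → s ≤ t → t ≤ T →
      ‖I t - I s‖ ≤ M * (t - s) ^ α + 1 / (1 - (2 : ℝ) ^ (1 - β)) * R * (t - s) ^ β := by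
    intro s t hs hst ht
    have h := norm_le_of_defect_le (E := fun s t => I t - I s - Γ s t) hβ
      (fun s u t hs hsu hut ht => by
        refine le_of_eq_of_le ?_ (hδ s u t hs hsu hut ht)
        rw [← norm_neg]
        congr 1
        abel) hK hs hst ht
    have h' := norm_sub_norm_le (I t - I s) (Γ s t)
    rw [one_div_mul_eq_div]
    linarith [hΓ s t hs hst ht]
  have hpos : ∀ M' : ℝ, 0 < M' → M ≤ M' → M' ≤ R → ‖I t - I s‖ ≤
      sewingInterpolationConst β T * (1 + R) * M' ^ ((β - 1) / (β - α)) * (t - s) ^ α := by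
    intro M' hM' hMM' hM'R
    refine norm_sub_le_of_interpolation hα0 hα1 hβ hT hc hM' hM'R (fun s t hs hst ht => ?_)
      hs hst ht
    have := sub_nonneg.2 hst
    exact (hrem s t hs hst ht).trans (by gcongr)
  rcases hM.eq_or_lt with rfl | hM0
  · have hcont : Continuous fun M' : ℝ =>
        sewingInterpolationConst β T * (1 + R) * M' ^ ((β - 1) / (β - α)) * (t - s) ^ α :=
      (continuous_const.mul (Real.continuous_rpow_const hp0.le)).mul continuous_const
    refine ge_of_tendsto (hcont.continuousWithinAt (s := Set.Ioi 0) (x := 0)) ?_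
    filter_upwards [Ioc_mem_nhdsGT hR] with M' hM'
    exact hpos M' hM'.1 hM'.1.le hM'.2
  · exact hpos M hM0 le_rfl hMR

theorem holderSemiOn_nonneg {V : Type*} [NormedAddCommGroup V] (α T : ℝ) (f : ℝ → V) :
    0 ≤ holderSemiOn α T f := by
  refine Real.sSup_nonneg ?_
  rintro r ⟨s, t, -, hst, -, rfl⟩
  have := sub_pos.2 hst
  positivity

theorem holderSemiOn_le {V : Type*} [NormedAddCommGroup V] {α T B : ℝ} {f : ℝ → V} (hB : 0 ≤ B)
    (hf : ∀ s t : ℝ, 0 ≤ s → s ≤ t → t ≤ T → ‖f t - f s‖ ≤ B * (t - s) ^ α) :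
    holderSemiOn α T f ≤ B := by
  refine Real.sSup_le ?_ hB
  rintro r ⟨s, t, hs, hst, ht, rfl⟩
  exact (div_le_iff₀ (Real.rpow_pos_of_pos (sub_pos.2 hst) α)).2 (hf s t hs hst.le ht)

/-- **Interpolation estimate for the sewing map.**  Let `0 < α < 1 < β`, `T > 0`, `R > 0`.
There is `C = C(T,β)` such that for every `Γ ∈ C₂^{α,β}([0,T];V)` with `‖δΓ‖_β ≤ R` and
`‖Γ‖_α ≤ ‖δΓ‖_β`, the sewing satisfies `⟦𝒥(Γ)⟧_α ≤ C (1+R) ‖Γ‖_α^{(β-1)/(β-α)}`.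
Consequently, if `sup_n ‖δΓⁿ‖_β ≤ R` and `‖Γⁿ‖_α → 0` then `𝒥(Γⁿ) → 0` in `C^α`. -/
theorem sewing_interpolation
    {V : Type*} [NormedAddCommGroup V] [NormedSpace ℝ V]
    (β T : ℝ) (hβ : 1 < β) (hT : 0 < T) :
    ∃ C : ℝ, 0 ≤ C ∧
      ((∀ α R : ℝ, 0 < α → α < 1 → 0 < R →
        ∀ (Γ : ℝ → ℝ → V) (I : ℝ → V) (MΓ Mδ : ℝ),
          (∀ s t : ℝ, 0 ≤ s → s ≤ t → t ≤ T → ‖Γ s t‖ ≤ MΓ * (t - s) ^ α) →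
          (∀ s u t : ℝ, 0 ≤ s → s ≤ u → u ≤ t → t ≤ T →
            ‖Γ s t - Γ s u - Γ u t‖ ≤ Mδ * (t - s) ^ β) →
          MΓ ≤ Mδ → Mδ ≤ R →
          I 0 = 0 →
          (∃ K : ℝ, ∀ s t : ℝ, 0 ≤ s → s ≤ t → t ≤ T →
            ‖I t - I s - Γ s t‖ ≤ K * (t - s) ^ β) →
          ∀ s t : ℝ, 0 ≤ s → s ≤ t → t ≤ T →
            ‖I t - I s‖ ≤ C * (1 + R) * MΓ ^ ((β - 1) / (β - α)) * (t - s) ^ α) ∧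
      (∀ α R : ℝ, 0 < α → α < 1 → 0 < R →
        ∀ (Γseq : ℕ → ℝ → ℝ → V) (Iseq : ℕ → ℝ → V) (Mseq : ℕ → ℝ),
          (∀ n : ℕ, ∀ s t : ℝ, 0 ≤ s → s ≤ t → t ≤ T →
            ‖Γseq n s t‖ ≤ Mseq n * (t - s) ^ α) →
          (∀ n : ℕ, ∀ s u t : ℝ, 0 ≤ s → s ≤ u → u ≤ t → t ≤ T →
            ‖Γseq n s t - Γseq n s u - Γseq n u t‖ ≤ R * (t - s) ^ β) →
          (∀ n : ℕ, Iseq n 0 = 0) →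
          (∀ n : ℕ, ∃ K : ℝ, ∀ s t : ℝ, 0 ≤ s → s ≤ t → t ≤ T →
            ‖Iseq n t - Iseq n s - Γseq n s t‖ ≤ K * (t - s) ^ β) →
          Filter.Tendsto Mseq Filter.atTop (nhds 0) →
          Filter.Tendsto (fun n => holderSemiOn α T (Iseq n)) Filter.atTop (nhds 0))) := by
  refine ⟨sewingInterpolationConst β T, sewingInterpolationConst_nonneg hβ hT, ?_, ?_⟩
  · intro α R hα0 hα1 hR Γ I MΓ Mδ hΓ hδ hMM hMR _ hI s t hs hst ht
    refine norm_sewing_sub_le hα0 hα1 hβ hT hR (hMM.trans hMR) hΓ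
      (fun s u t hs hsu hut ht => (hδ s u t hs hsu hut ht).trans ?_) hI hs hst ht
    have : 0 ≤ t - s := by linarith
    gcongr
  · intro α R hα0 hα1 hR Γ I M hΓ hδ _ hI hM
    have hp0 : 0 < (β - 1) / (β - α) := div_pos (by linarith) (by linarith)
    have hlim : Filter.Tendsto (fun n => sewingInterpolationConst β T * (1 + R) *
        M n ^ ((β - 1) / (β - α))) Filter.atTop (nhds 0) := by
      simpa [Real.zero_rpow hp0.ne'] using
        (hM.rpow_const (Or.inr hp0.le)).const_mul (sewingInterpolationConst β T * (1 + R))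
    refine squeeze_zero' (Filter.Eventually.of_forall fun n => holderSemiOn_nonneg α T (I n))
      ?_ hlim
    filter_upwards [hM.eventually_le_const hR] with n hn
    have hM0 := nonneg_of_germ_bound hT (hΓ n)
    have hC0 := sewingInterpolationConst_nonneg hβ hT
    exact holderSemiOn_le (by positivity) fun s t hs hst ht =>
      norm_sewing_sub_le hα0 hα1 hβ hT hR hn (hΓ n) (hδ n) (hI n) hs hst ht
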